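/- Fix an odd integer γ ≥ 3 and set t = (γ+1)²/2, r = (−t, γ+1), b = (2t, γ+1), w_r = √(t²+2t), w_b = √(4t²+2t). Let the red points be (0,2i) for i ∈ {1,…,γ} together with r, and the blue points be (1,2i+1) for i ∈ {1,…,γ−1} together with b. Then every red point x satisfies ‖x−r‖/w_r < ‖x−b‖/w_b, and every blue point x satisfies ‖x−b‖/w_b < ‖x−r‖/w_r; i.e., the two-point weighted set ({r,b}, w) is WNN-consistent with the whole dataset. -/

import Mathlib

noncomputable section
open Classical

/-- The Euclidean plane. -/
abbrev Pt := EuclideanSpace ℝ (Fin 2)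

/-- The point `(a, b)` of the Euclidean plane. -/
def pt (a b : ℝ) : Pt := (WithLp.equiv 2 (Fin 2 → ℝ)).symm ![a, b]

/-- `t = (γ+1)²/2`. -/
def tval (γ : ℕ) : ℝ := ((γ : ℝ) + 1) ^ 2 / 2

theorem dist_pt (a b c d : ℝ) :
    dist (pt a b) (pt c d) = Real.sqrt ((a - c) ^ 2 + (b - d) ^ 2) := by
  simp [pt, EuclideanSpace.dist_eq, Real.dist_eq, sq_abs]

/-- Comparison of weighted distances with positive squared weights reduces to
cross-multiplied squared distances. -/
theorem dist_pt_div_sqrt_lt {a b c d a' b' c' d' A B : ℝ} (hA : 0 < A) (hB : 0 < B)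
    (h : ((a - c) ^ 2 + (b - d) ^ 2) * B < ((a' - c') ^ 2 + (b' - d') ^ 2) * A) :
    dist (pt a b) (pt c d) / Real.sqrt A < dist (pt a' b') (pt c' d') / Real.sqrt B := by
  rw [dist_pt, dist_pt, ← Real.sqrt_div (by positivity), ← Real.sqrt_div (by positivity)]
  exact Real.sqrt_lt_sqrt (by positivity) ((div_lt_div_iff₀ hA hB).2 h)

/-- For odd `γ ≥ 3`, with `t = (γ+1)²/2`, `r = (-t, γ+1)`, `b = (2t, γ+1)`,
`w_r = √(t²+2t)`, `w_b = √(4t²+2t)`: every red point (the points `(0,2i)`,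
`i ∈ {1,…,γ}`, and `r`) is strictly weighted-closer to `r` than to `b`, and every
blue point (the points `(1,2i+1)`, `i ∈ {1,…,γ-1}`, and `b`) is strictly
weighted-closer to `b` than to `r`. -/
theorem stmt8 (γ : ℕ) (hodd : Odd γ) (hγ : 3 ≤ γ) :
    (∀ i ∈ Finset.Icc 1 γ,
      dist (pt 0 (2 * (i : ℝ))) (pt (-(tval γ)) ((γ : ℝ) + 1)) /
          Real.sqrt ((tval γ) ^ 2 + 2 * tval γ) <
        dist (pt 0 (2 * (i : ℝ))) (pt (2 * tval γ) ((γ : ℝ) + 1)) /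
          Real.sqrt (4 * (tval γ) ^ 2 + 2 * tval γ)) ∧
    (dist (pt (-(tval γ)) ((γ : ℝ) + 1)) (pt (-(tval γ)) ((γ : ℝ) + 1)) /
          Real.sqrt ((tval γ) ^ 2 + 2 * tval γ) <
        dist (pt (-(tval γ)) ((γ : ℝ) + 1)) (pt (2 * tval γ) ((γ : ℝ) + 1)) /
          Real.sqrt (4 * (tval γ) ^ 2 + 2 * tval γ)) ∧
    (∀ i ∈ Finset.Icc 1 (γ - 1),
      dist (pt 1 (2 * (i : ℝ) + 1)) (pt (2 * tval γ) ((γ : ℝ) + 1)) /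
          Real.sqrt (4 * (tval γ) ^ 2 + 2 * tval γ) <
        dist (pt 1 (2 * (i : ℝ) + 1)) (pt (-(tval γ)) ((γ : ℝ) + 1)) /
          Real.sqrt ((tval γ) ^ 2 + 2 * tval γ)) ∧
    (dist (pt (2 * tval γ) ((γ : ℝ) + 1)) (pt (2 * tval γ) ((γ : ℝ) + 1)) /
          Real.sqrt (4 * (tval γ) ^ 2 + 2 * tval γ) <
        dist (pt (2 * tval γ) ((γ : ℝ) + 1)) (pt (-(tval γ)) ((γ : ℝ) + 1)) /
          Real.sqrt ((tval γ) ^ 2 + 2 * tval γ)) := by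
  have hg : (3 : ℝ) ≤ γ := by exact_mod_cast hγ
  have ht : 0 < tval γ := by unfold tval; positivity
  have h2t : ((γ : ℝ) + 1) ^ 2 = 2 * tval γ := by unfold tval; ring
  generalize tval γ = t at *
  have hr : 0 < t ^ 2 + 2 * t := by positivity
  have hb : 0 < 4 * t ^ 2 + 2 * t := by positivity
  refine ⟨fun i hi ↦ dist_pt_div_sqrt_lt hr hb ?_, dist_pt_div_sqrt_lt hr hb ?_,
    fun i _ ↦ dist_pt_div_sqrt_lt hb hr ?_, dist_pt_div_sqrt_lt hb hr ?_⟩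
  · obtain ⟨h1, h2⟩ := Finset.mem_Icc.1 hi
    have h1 : (1 : ℝ) ≤ i := by exact_mod_cast h1
    have h2 : (i : ℝ) ≤ γ := by exact_mod_cast h2
    have hd : (2 * (i : ℝ) - (γ + 1)) ^ 2 < 2 * t := by
      rw [← h2t]
      exact sq_lt_sq' (by linarith) (by linarith)
    generalize (2 * (i : ℝ) - (γ + 1)) ^ 2 = D at *
    linear_combination 3 * t ^ 2 * hd
  · rw [← sub_pos]
    ring_nf
    positivity
  · have hd : 0 ≤ (2 * (i : ℝ) + 1 - (γ + 1)) ^ 2 := sq_nonneg _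
    generalize (2 * (i : ℝ) + 1 - (γ + 1)) ^ 2 = D at *
    have hpos : 0 < t * (6 * t ^ 2 + 15 * t + 3 * t * D) := by positivity
    linear_combination hpos
  · rw [← sub_pos]
    ring_nf
    positivity
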